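/- arXiv:2311.18562 — 3 statements merged into one kernel-verified Lean document; each statement's English description precedes it below -/
import Mathlib

section
/- Let R ⊆ E_n be a parabolic type, S ⊆ E_n a nonempty subset, γ : S → 𝒫(E_n) a function and C_γ the associated S-adapted p-cone. Then 𝒞_{pHa,S} ⊆ C_γ holds if and only if for every i ∈ S the set γ(i) is admissible with respect to R and S and γ(i) is j-positive for every j ∈ (S ∖ γ(i)) ∪ {i}. -/
open scoped Pointwise

/-- The sign `δ_A^{(i)}`: `-1` if `i ∈ A`, `1` otherwise. -/
def sgn {n : ℕ} (A : Finset (ZMod n)) (i : ZMod n) : ℤ := if i ∈ A then -1 else 1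

/-- The `p`-expression `F_T^{(d)}(x) = Σ_{i=0}^{n−1} p^i δ_T^{(d+i)} x_{d+i}`. -/
def pExpr (p : ℕ) {n : ℕ} (T : Finset (ZMod n)) (d : ZMod n) (x : ZMod n → ℤ) : ℤ :=
  ∑ i ∈ Finset.range n, (p : ℤ) ^ i * sgn T (d + (i : ZMod n)) * x (d + (i : ZMod n))

/-- The `S`-adapted `p`-cone associated to `γ`. -/
def adapCone (p : ℕ) {n : ℕ} (S : Finset (ZMod n)) (γ : ZMod n → Finset (ZMod n)) :
    Set (ZMod n → ℤ) :=
  {x | ∀ i ∈ S, pExpr p (γ i) i x ≤ 0}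

/-- The vector `ha_{R,S}^{(i)}`. -/
def haVec (p : ℕ) {n : ℕ} (R S : Finset (ZMod n)) (i : ZMod n) : ZMod n → ℤ :=
  (if i ∈ S then (1 : ℤ) else -1) • Pi.single i (1 : ℤ)
    - ((p : ℤ) * sgn R (i - 1)) • Pi.single (i - 1) (1 : ℤ)

/-- Saturation of a subset of `ℤ^n`. -/
def satur {n : ℕ} (C : Set (ZMod n → ℤ)) : Set (ZMod n → ℤ) :=
  {x | ∃ m : ℕ, 1 ≤ m ∧ (m : ℤ) • x ∈ C}

/-- The cone of partial Hasse invariants `𝒞_{pHa,S}`. -/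
def CpHa (p : ℕ) {n : ℕ} [NeZero n] (R S : Finset (ZMod n)) : Set (ZMod n → ℤ) :=
  satur {x | ∃ c : ZMod n → ℤ, (∀ i ∈ S, 0 ≤ c i) ∧ x = ∑ i, c i • haVec p R S i}

/-- The kernel `𝕂_{R,S}`. -/
def haKer (p : ℕ) {n : ℕ} [NeZero n] (R S : Finset (ZMod n)) : Set (ZMod n → ℤ) :=
  satur {x | ∃ c : ZMod n → ℤ, (∀ i ∈ S, c i = 0) ∧ x = ∑ i, c i • haVec p R S i}

/-- `T` is admissible with respect to `R` and `S`. -/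
def Admissible {n : ℕ} (R S T : Finset (ZMod n)) : Prop :=
  ∀ i : ZMod n, i + 1 ∉ S →
    if i ∈ R then (i ∈ T ↔ i + 1 ∈ T) else (i ∈ T ↔ i + 1 ∉ T)

/-- `T` is `i`-positive. -/
def IPositive {n : ℕ} (R T : Finset (ZMod n)) (i : ZMod n) : Prop :=
  i - 1 ∈ T ↔ i - 1 ∈ R

/-- Rewriting a `p`-expression as a sum over `ZMod n`. -/
theorem pExpr_eq_sum (p : ℕ) {n : ℕ} [NeZero n] (T : Finset (ZMod n)) (d : ZMod n)
    (x : ZMod n → ℤ) :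
    pExpr p T d x = ∑ j, (p : ℤ) ^ (j - d).val * sgn T j * x j := by
  unfold pExpr
  refine Finset.sum_bij' (fun i _ => d + (i : ZMod n)) (fun j _ => (j - d).val)
    (by simp) (fun j _ => Finset.mem_range.2 (ZMod.val_lt _)) ?_ ?_ ?_
  · intro i hi
    simpa using ZMod.val_cast_of_lt (Finset.mem_range.1 hi)
  · intro j _
    simp
  · intro i hi
    have h : (d + (i : ZMod n) - d).val = i := by
      simpa using ZMod.val_cast_of_lt (Finset.mem_range.1 hi)
    rw [h]

theorem pExpr_smul (p : ℕ) {n : ℕ} [NeZero n] (T : Finset (ZMod n)) (d : ZMod n)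
    (m : ℤ) (x : ZMod n → ℤ) : pExpr p T d (m • x) = m * pExpr p T d x := by
  simp only [pExpr_eq_sum, Finset.mul_sum, Pi.smul_apply, smul_eq_mul]
  exact Finset.sum_congr rfl fun _ _ => by ring

theorem pExpr_sum_smul (p : ℕ) {n : ℕ} [NeZero n] (T : Finset (ZMod n)) (d : ZMod n)
    (c : ZMod n → ℤ) (v : ZMod n → ZMod n → ℤ) :
    pExpr p T d (∑ j, c j • v j) = ∑ j, c j * pExpr p T d (v j) := by
  simp only [pExpr_eq_sum, Finset.mul_sum, Finset.sum_apply, Pi.smul_apply, smul_eq_mul]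
  rw [Finset.sum_comm]
  exact Finset.sum_congr rfl fun _ _ => Finset.sum_congr rfl fun _ _ => by ring

theorem mul_pow_val_sub_one (p : ℕ) {n : ℕ} [NeZero n] (a : ZMod n) :
    (p : ℤ) * (p : ℤ) ^ (a - 1).val = if a = 0 then (p : ℤ) ^ n else (p : ℤ) ^ a.val := by
  obtain ⟨b, rfl⟩ : ∃ b, a = b + 1 := ⟨a - 1, by ring⟩
  have hb : ((b.val + 1 : ℕ) : ZMod n) = b + 1 := by simp
  rw [add_sub_cancel_right, ← pow_succ']
  rcases (Nat.succ_le_of_lt (ZMod.val_lt b)).lt_or_eq with h | h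
  · have hv : (b + 1).val = b.val + 1 := by rw [← hb]; exact ZMod.val_cast_of_lt h
    have h0 : b + 1 ≠ 0 := fun h0 => by simp [h0] at hv
    rw [if_neg h0, hv]
  · have h0 : b + 1 = 0 := by rw [← hb, ← Nat.succ_eq_add_one, h, ZMod.natCast_self]
    rw [if_pos h0]
    exact congrArg _ h

theorem pExpr_haVec (p : ℕ) {n : ℕ} [NeZero n] (R S T : Finset (ZMod n)) (d j : ZMod n) :
    pExpr p T d (haVec p R S j) =
      (p : ℤ) ^ (j - d).val * ((if j ∈ S then 1 else -1) * sgn T j)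
        - (if j = d then (p : ℤ) ^ n else (p : ℤ) ^ (j - d).val)
          * (sgn R (j - 1) * sgn T (j - 1)) := by
  have hw := mul_pow_val_sub_one p (j - d)
  rw [sub_right_comm] at hw
  simp only [sub_eq_zero] at hw
  rw [← hw, pExpr_eq_sum]
  simp only [haVec, Pi.sub_apply, Pi.smul_apply, smul_eq_mul, mul_sub, Finset.sum_sub_distrib,
    Pi.single_apply, mul_ite, mul_one, mul_zero, Finset.sum_ite_eq', Finset.mem_univ, if_true]
  split_ifs <;> ring

theorem pExpr_haVec_self_nonpos_iff {p : ℕ} (hp : p.Prime) {n : ℕ} [NeZero n]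
    {R S T : Finset (ZMod n)} {d : ZMod n} (hd : d ∈ S) :
    pExpr p T d (haVec p R S d) ≤ 0 ↔ IPositive R T d := by
  have h1 : (1 : ℤ) < (p : ℤ) ^ n := one_lt_pow₀ (by exact_mod_cast hp.one_lt) (NeZero.ne n)
  rw [pExpr_haVec]
  simp only [hd, sub_self, ZMod.val_zero, pow_zero, if_true, IPositive, sgn]
  split_ifs <;> simp_all <;> linarith

theorem pExpr_haVec_nonpos_iff {p : ℕ} (hp : p.Prime) {n : ℕ} [NeZero n]
    {R S T : Finset (ZMod n)} {d j : ZMod n} (hj : j ∈ S) (hjd : j ≠ d) :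
    pExpr p T d (haVec p R S j) ≤ 0 ↔ (j ∉ T → IPositive R T j) := by
  have h1 : (0 : ℤ) < (p : ℤ) ^ (j - d).val := pow_pos (by exact_mod_cast hp.pos) _
  rw [pExpr_haVec]
  simp only [hj, hjd, if_true, if_false, IPositive, sgn]
  split_ifs <;> simp_all

theorem pExpr_haVec_eq_zero_iff {p : ℕ} (hp : p.Prime) {n : ℕ} [NeZero n]
    {R S T : Finset (ZMod n)} {d j : ZMod n} (hj : j ∉ S) (hjd : j ≠ d) :
    pExpr p T d (haVec p R S j) = 0 ↔
      if j - 1 ∈ R then (j - 1 ∈ T ↔ j ∈ T) else (j - 1 ∈ T ↔ j ∉ T) := by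
  have h1 : (0 : ℤ) < (p : ℤ) ^ (j - d).val := pow_pos (by exact_mod_cast hp.pos) _
  rw [pExpr_haVec]
  simp only [hj, hjd, if_false, sgn]
  have h0 := hp.ne_zero
  split_ifs <;> simp_all <;> linarith

theorem smul_haVec_mem_CpHa (p : ℕ) {n : ℕ} [NeZero n] {R S : Finset (ZMod n)} {j : ZMod n}
    {a : ℤ} (ha : j ∈ S → 0 ≤ a) : a • haVec p R S j ∈ CpHa p R S := by
  refine ⟨1, le_rfl, Pi.single j a, fun i hi => ?_, ?_⟩
  · rcases eq_or_ne i j with rfl | h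
    · simpa using ha hi
    · simp [h]
  · rw [Finset.sum_eq_single j (fun i _ h => by simp [h]) (by simp)]
    simp

/-- The cone of partial Hasse invariants lies in a half-space exactly when its generators do. -/
theorem forall_mem_CpHa_pExpr_nonpos_iff (p : ℕ) {n : ℕ} [NeZero n]
    (R S T : Finset (ZMod n)) (d : ZMod n) :
    (∀ x ∈ CpHa p R S, pExpr p T d x ≤ 0) ↔
      (∀ j ∈ S, pExpr p T d (haVec p R S j) ≤ 0) ∧
        ∀ j ∉ S, pExpr p T d (haVec p R S j) = 0 := by
  constructor
  · intro h
    have key (j : ZMod n) (a : ℤ) (ha : j ∈ S → 0 ≤ a) :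
        a * pExpr p T d (haVec p R S j) ≤ 0 := by
      rw [← pExpr_smul]
      exact h _ (smul_haVec_mem_CpHa p ha)
    refine ⟨fun j _ => by simpa using key j 1 (by simp), fun j hj => ?_⟩
    have h1 := key j 1 (by simp)
    have h2 := key j (-1) (fun h => absurd h hj)
    linarith
  · rintro ⟨hS, hS'⟩ x ⟨m, hm, c, hc, hx⟩
    have hle : (m : ℤ) * pExpr p T d x ≤ 0 := by
      rw [← pExpr_smul, hx, pExpr_sum_smul]
      refine Finset.sum_nonpos fun j _ => ?_
      by_cases hj : j ∈ S
      · exact mul_nonpos_of_nonneg_of_nonpos (hc j hj) (hS j hj)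
      · simp [hS' j hj]
    exact nonpos_of_mul_nonpos_right hle (by exact_mod_cast hm)

/-- Proposition 4.14: `𝒞_{pHa,S} ⊆ C_γ` holds if and only if for every `i ∈ S` the set `γ(i)`
is admissible w.r.t. `R` and `S`, and `γ(i)` is `j`-positive for every
`j ∈ (S ∖ γ(i)) ∪ {i}`. -/
theorem CpHa_subset_iff (p : ℕ) (hp : p.Prime) {n : ℕ} [NeZero n]
    (R S : Finset (ZMod n)) (hS : S.Nonempty) (γ : ZMod n → Finset (ZMod n)) :
    CpHa p R S ⊆ adapCone p S γ ↔
      ∀ i ∈ S, Admissible R S (γ i) ∧ ∀ j ∈ (S \ γ i) ∪ {i}, IPositive R (γ i) j := by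
  have hcone : CpHa p R S ⊆ adapCone p S γ ↔
      ∀ i ∈ S, ∀ x ∈ CpHa p R S, pExpr p (γ i) i x ≤ 0 :=
    ⟨fun h i hi x hx => h hx i hi, fun h x hx i hi => h i hi x hx⟩
  rw [hcone]
  refine forall₂_congr fun i hi => ?_
  rw [forall_mem_CpHa_pExpr_nonpos_iff, and_comm]
  refine and_congr ⟨fun h j hj => ?_, fun h j hj => ?_⟩ ⟨fun h j hj => ?_, fun h j hj => ?_⟩
  · have hne : j + 1 ≠ i := fun e => hj (e ▸ hi)
    simpa using (pExpr_haVec_eq_zero_iff hp hj hne).1 (h _ hj)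
  · have hne : j ≠ i := fun e => hj (e ▸ hi)
    rw [pExpr_haVec_eq_zero_iff hp hj hne]
    simpa using h (j - 1) (by simpa using hj)
  · rcases eq_or_ne j i with rfl | hne
    · exact (pExpr_haVec_self_nonpos_iff hp hi).1 (h _ hi)
    · have hj' : j ∈ S ∧ j ∉ γ i := by simpa [hne] using hj
      exact (pExpr_haVec_nonpos_iff hp hj'.1 hne).1 (h _ hj'.1) hj'.2
  · rcases eq_or_ne j i with rfl | hne
    · exact (pExpr_haVec_self_nonpos_iff hp hi).2 (h _ (by simp))
    · exact (pExpr_haVec_nonpos_iff hp hj hne).2 fun hT => h _ (by simp [hj, hT])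
end

section
/- Let R ⊆ E_n be a parabolic type, S ⊆ E_n a nonempty subset, T = Φ_R(S), and for i ∈ S set gen_{R,S}^{(i)} = δ_T^{(i)} e_i − p δ_R^{(i−1)} e_{i−1}. Then each gen_{R,S}^{(i)} lies in 𝒞_{R,S}, and the gen_{R,S}^{(i)} form a system of ℚ_{≥0}-generators of 𝒞_{R,S} modulo kernel: for every x ∈ 𝒞_{R,S} there exist rational numbers c_i ≥ 0 (i ∈ S) and an element y in the ℚ-linear span of 𝕂_{R,S} such that x = Σ_{i∈S} c_i · gen_{R,S}^{(i)} + y in ℚ^n. Consequently, 𝒞_{R,S} is the saturation of the monoid Σ_{i∈S} ℕ·gen_{R,S}^{(i)} + 𝕂_{R,S}. -/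
open scoped Pointwise

/-- The vector `gen_{R,S}^{(i)} = δ_T^{(i)} e_i − p δ_R^{(i−1)} e_{i−1}`,
where `T = Φ_R(S)`. -/
def genVec (p : ℕ) {n : ℕ} (R T : Finset (ZMod n)) (i : ZMod n) : ZMod n → ℤ :=
  sgn T i • Pi.single i (1 : ℤ) - ((p : ℤ) * sgn R (i - 1)) • Pi.single (i - 1) (1 : ℤ)

theorem sgn_mul_sgn {n : ℕ} (A : Finset (ZMod n)) (i : ZMod n) : sgn A i * sgn A i = 1 := by
  unfold sgn; split_ifs <;> rfl

/-- `pExpr` as a linear form. -/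
def pExprLin (p : ℕ) {n : ℕ} (T : Finset (ZMod n)) (d : ZMod n) : (ZMod n → ℤ) →ₗ[ℤ] ℤ where
  toFun := pExpr p T d
  map_add' x y := by simp [pExpr, mul_add, Finset.sum_add_distrib]
  map_smul' m x := by
    simp only [pExpr, Pi.smul_apply, smul_eq_mul, Finset.mul_sum, RingHom.id_apply]
    exact Finset.sum_congr rfl fun _ _ => by ring

/-- The vector `δ_T^{(i)} e_i − p δ_T^{(i−1)} e_{i−1}`, dual up to scaling to the linear form
`F_T^{(i)}`. -/
def dualVec (p : ℕ) {n : ℕ} (T : Finset (ZMod n)) (i : ZMod n) : ZMod n → ℤ :=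
  sgn T i • Pi.single i (1 : ℤ) - ((p : ℤ) * sgn T (i - 1)) • Pi.single (i - 1) (1 : ℤ)

theorem sum_pow_mul_sub (p : ℤ) {n : ℕ} (h : ZMod n → ℤ) (d : ZMod n) :
    ∑ k ∈ Finset.range n, p ^ k * (h (d + k) - p * h (d + k + 1)) = (1 - p ^ n) * h d := by
  have := Finset.sum_range_sub' (fun k : ℕ => p ^ k * h (d + k)) n
  simp only [pow_zero, Nat.cast_zero, add_zero, one_mul, ZMod.natCast_self] at this
  rw [sub_mul, one_mul, ← this]
  refine Finset.sum_congr rfl fun k _ => ?_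
  push_cast
  rw [add_assoc]
  ring

theorem sgn_mul_dualVec (p : ℕ) {n : ℕ} (T : Finset (ZMod n)) (i j : ZMod n) :
    sgn T j * dualVec p T i j = (if j = i then 1 else 0) - p * (if j + 1 = i then 1 else 0) := by
  have hs := sgn_mul_sgn T
  have hj : j = i - 1 ↔ j + 1 = i := eq_sub_iff_add_eq
  simp only [dualVec, Pi.sub_apply, Pi.smul_apply, Pi.single_apply, smul_eq_mul, hj, mul_sub]
  congr 1
  · split_ifs with h
    · subst h; simp [hs]
    · simp
  · split_ifs with h
    · subst h
      rw [add_sub_cancel_right]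
      linear_combination (p : ℤ) * hs j
    · simp

theorem pExpr_dualVec (p : ℕ) {n : ℕ} (T : Finset (ZMod n)) (d i : ZMod n) :
    pExpr p T d (dualVec p T i) = if d = i then 1 - (p : ℤ) ^ n else 0 := by
  simp only [pExpr, mul_assoc, sgn_mul_dualVec]
  rw [sum_pow_mul_sub (p : ℤ) (fun j => if j = i then 1 else 0) d]
  simp

theorem pExpr_sub_mul_pExpr (p : ℕ) {n : ℕ} (T : Finset (ZMod n)) (d : ZMod n)
    (x : ZMod n → ℤ) :
    pExpr p T d x - p * pExpr p T (d + 1) x = (1 - (p : ℤ) ^ n) * (sgn T d * x d) := by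
  rw [← sum_pow_mul_sub (p : ℤ) (fun j => sgn T j * x j) d]
  simp only [pExpr, Finset.mul_sum, ← Finset.sum_sub_distrib]
  refine Finset.sum_congr rfl fun k _ => ?_
  rw [add_right_comm d 1]
  ring

theorem smul_eq_sum_pExpr_smul_dualVec (p : ℕ) {n : ℕ} [NeZero n] (T : Finset (ZMod n))
    (x : ZMod n → ℤ) :
    ((p : ℤ) ^ n - 1) • x = ∑ i, (-pExpr p T i x) • dualVec p T i := by
  ext j
  have h : sgn T j * ∑ i, (-pExpr p T i x) * dualVec p T i j
      = -(pExpr p T j x - p * pExpr p T (j + 1) x) := by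
    rw [Finset.mul_sum]
    simp_rw [mul_left_comm (sgn T j), sgn_mul_dualVec]
    simp only [mul_sub, Finset.sum_sub_distrib, mul_ite, mul_one, mul_zero, Finset.sum_ite_eq,
      Finset.mem_univ, if_true]
    ring
  rw [pExpr_sub_mul_pExpr] at h
  simp only [Pi.smul_apply, smul_eq_mul, Finset.sum_apply]
  linear_combination (-sgn T j) * h +
    (∑ i, (-pExpr p T i x) * dualVec p T i j - ((p : ℤ) ^ n - 1) * x j) * sgn_mul_sgn T j

theorem genVec_eq_dualVec (p : ℕ) {n : ℕ} {R T : Finset (ZMod n)} {i : ZMod n}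
    (h : IPositive R T i) : genVec p R T i = dualVec p T i := by
  have h' : i - 1 ∈ T ↔ i - 1 ∈ R := h
  simp only [genVec, dualVec, sgn, h']

theorem haVec_eq_smul_dualVec (p : ℕ) {n : ℕ} {R S T : Finset (ZMod n)}
    (hT : Admissible R S T) {i : ZMod n} (hi : i ∉ S) :
    haVec p R S i = (-sgn T i) • dualVec p T i := by
  have h := hT (i - 1)
  rw [sub_add_cancel] at h
  replace h := h hi
  have h2 : sgn R (i - 1) = -(sgn T i * sgn T (i - 1)) := by
    unfold sgn
    split_ifs at h ⊢ <;> simp_all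
  rw [haVec, if_neg hi, dualVec, smul_sub, smul_smul, smul_smul, h2, neg_mul, sgn_mul_sgn]
  congr 2
  ring

theorem dualVec_eq_smul_haVec (p : ℕ) {n : ℕ} {R S T : Finset (ZMod n)}
    (hT : Admissible R S T) {i : ZMod n} (hi : i ∉ S) :
    dualVec p T i = (-sgn T i) • haVec p R S i := by
  rw [haVec_eq_smul_dualVec p hT hi, smul_smul, neg_mul_neg, sgn_mul_sgn, one_smul]

theorem sum_smul_dualVec_mem_haKer (p : ℕ) {n : ℕ} [NeZero n] {R S T : Finset (ZMod n)}
    (hT : Admissible R S T) (a : ZMod n → ℤ) :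
    ∑ i ∈ Sᶜ, a i • dualVec p T i ∈ haKer p R S := by
  refine ⟨1, le_rfl, fun i => if i ∈ S then 0 else a i * (-sgn T i), fun i hi => if_pos hi, ?_⟩
  rw [Nat.cast_one, one_smul]
  refine Finset.sum_subset_zero_on_sdiff (Finset.subset_univ _) (fun i hi => ?_) fun i hi => ?_
  · have hi' : i ∈ S := by simpa using hi
    simp only [if_pos hi', zero_smul]
  · have hi' : i ∉ S := Finset.mem_compl.mp hi
    simp only [if_neg hi', dualVec_eq_smul_haVec p hT hi', smul_smul]

theorem pExpr_eq_zero_of_mem_haKer {p : ℕ} {n : ℕ} [NeZero n] {R S T : Finset (ZMod n)}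
    (hT : Admissible R S T) {d : ZMod n} (hd : d ∈ S) {k : ZMod n → ℤ} (hk : k ∈ haKer p R S) :
    pExpr p T d k = 0 := by
  obtain ⟨m, hm, c, hc, h⟩ := hk
  have h2 := congrArg (pExprLin p T d) h
  rw [map_smul, map_sum, Finset.sum_eq_zero] at h2
  · exact (smul_eq_zero.mp h2).resolve_left (by omega)
  · intro i _
    by_cases hi : i ∈ S
    · rw [hc i hi, zero_smul, map_zero]
    · have hdi : d ≠ i := fun e => hi (e ▸ hd)
      have h3 : pExprLin p T d (dualVec p T i) = 0 :=
        (pExpr_dualVec p T d i).trans (if_neg hdi)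
      rw [haVec_eq_smul_dualVec p hT hi, map_smul, map_smul, h3, smul_zero, smul_zero]

/-- Proposition 4.26: the vectors `gen_{R,S}^{(i)}` (`i ∈ S`) lie in `𝒞_{R,S}` and form a
system of `ℚ_{≥0}`-generators of `𝒞_{R,S}` modulo kernel; consequently `𝒞_{R,S}` is the
saturation of `Σ_{i∈S} ℕ·gen_{R,S}^{(i)} + 𝕂_{R,S}`. Here `T = Φ_R(S)` is the unique subset
admissible w.r.t. `R,S` and `i`-positive for all `i ∈ S`, and
`𝒞_{R,S} = adapCone p S (fun _ => T)`. -/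
theorem genVec_generate (p : ℕ) (hp : p.Prime) {n : ℕ} [NeZero n]
    (R S : Finset (ZMod n)) (hS : S.Nonempty) (T : Finset (ZMod n))
    (hTadm : Admissible R S T) (hTpos : ∀ i ∈ S, IPositive R T i) :
    (∀ i ∈ S, genVec p R T i ∈ adapCone p S (fun _ => T)) ∧
    (∀ x ∈ adapCone p S (fun _ => T), ∃ c : ZMod n → ℚ,
      (∀ i ∈ S, 0 ≤ c i) ∧
      ∃ y ∈ Submodule.span ℚ
          ((fun (v : ZMod n → ℤ) => fun j => ((v j : ℚ))) '' haKer p R S),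
        (fun j => ((x j : ℚ))) =
          (∑ i ∈ S, c i • fun j => ((genVec p R T i j : ℚ))) + y) ∧
    adapCone p S (fun _ => T) =
      satur ({z | ∃ c : ZMod n → ℤ, (∀ i, 0 ≤ c i) ∧ z = ∑ i ∈ S, c i • genVec p R T i}
        + haKer p R S) := by
  have hgen : ∀ i ∈ S, genVec p R T i = dualVec p T i :=
    fun i hi => genVec_eq_dualVec p (hTpos i hi)
  have hp1 : 1 < p ^ n := Nat.one_lt_pow (NeZero.ne n) hp.one_lt
  have hpZ : (1 : ℤ) < (p : ℤ) ^ n := mod_cast hp1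
  have hpQ : (0 : ℚ) < (p : ℚ) ^ n - 1 := sub_pos.mpr (mod_cast hp1)
  have hmem : ∀ i ∈ S, genVec p R T i ∈ adapCone p S (fun _ => T) := by
    intro i hi d _
    rw [hgen i hi, pExpr_dualVec]
    split_ifs <;> linarith
  have hexp : ∀ x : ZMod n → ℤ, ((p : ℤ) ^ n - 1) • x =
      ∑ i ∈ S, (-pExpr p T i x) • genVec p R T i + ∑ i ∈ Sᶜ, (-pExpr p T i x) • dualVec p T i := by
    intro x
    rw [smul_eq_sum_pExpr_smul_dualVec p T x, ← Finset.sum_add_sum_compl S]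
    exact congrArg (· + _) (Finset.sum_congr rfl fun i hi => by rw [hgen i hi])
  refine ⟨hmem, fun x hx => ?_, Set.ext fun x => ⟨fun hx => ?_, ?_⟩⟩
  · set w := ∑ i ∈ Sᶜ, (-pExpr p T i x) • dualVec p T i with hw
    refine ⟨fun i => ((-pExpr p T i x : ℤ) : ℚ) / ((p : ℚ) ^ n - 1), fun i hi =>
      div_nonneg (Int.cast_nonneg (neg_nonneg.mpr (hx i hi))) hpQ.le,
      ((p : ℚ) ^ n - 1)⁻¹ • fun j => (w j : ℚ),
      Submodule.smul_mem _ _ (Submodule.subset_span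
        ⟨w, sum_smul_dualVec_mem_haKer p hTadm _, rfl⟩), ?_⟩
    ext j
    have h := congrArg (Int.cast : ℤ → ℚ) (congrFun (hexp x) j)
    rw [← hw] at h
    simp only [Pi.smul_apply, Pi.add_apply, smul_eq_mul, Finset.sum_apply] at h ⊢
    push_cast at h ⊢
    simp_rw [div_mul_eq_mul_div]
    rw [← Finset.sum_div]
    field_simp
    simp only [neg_mul] at h
    linarith
  · refine ⟨p ^ n - 1, by omega, ?_⟩
    rw [Nat.cast_sub hp1.le, Nat.cast_pow, Nat.cast_one, hexp x]
    refine Set.add_mem_add ⟨fun i => if i ∈ S then -pExpr p T i x else 0, fun i => ?_, ?_⟩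
      (sum_smul_dualVec_mem_haKer p hTadm _)
    · dsimp only
      split_ifs with hi
      · exact neg_nonneg.mpr (hx i hi)
      · exact le_rfl
    · exact Finset.sum_congr rfl fun i hi => by simp only [if_pos hi]
  · rintro ⟨m, hm, h⟩ d hd
    obtain ⟨_, ⟨c, hc, rfl⟩, k, hk, hzk⟩ := Set.mem_add.mp h
    have h2 := congrArg (pExprLin p T d) hzk
    have hk0 : pExprLin p T d k = 0 := pExpr_eq_zero_of_mem_haKer hTadm hd hk
    rw [map_add, hk0, add_zero, map_sum, map_smul, smul_eq_mul] at h2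
    have h3 : ∑ i ∈ S, pExprLin p T d (c i • genVec p R T i) ≤ 0 := by
      refine Finset.sum_nonpos fun i hi => ?_
      rw [map_smul, smul_eq_mul]
      exact mul_nonpos_of_nonneg_of_nonpos (hc i) (hmem i hi d hd)
    rw [h2] at h3
    exact nonpos_of_mul_nonpos_right h3 (by exact_mod_cast hm)
end

section
/- Let R ⊆ E_n be a parabolic type, S ⊆ E_n a subset with |S| ≥ 2, j ∈ S, and let j⁻ ∈ S be the element of S that j follows (i.e. j is the first element of S in the sequence j⁻+1, j⁻+2, …). Then exactly one of the following holds: either Φ_R(S ∖ {j}) = Φ_R(S), or Φ_R(S ∖ {j}) agrees with Φ_R(S) outside the cyclic interval [j⁻, j[ and Φ_R(S ∖ {j}) ∩ [j⁻, j[ is the complement of Φ_R(S) ∩ [j⁻, j[ inside [j⁻, j[. -/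
open scoped Pointwise

/-- `b` is the element of `S` following `a`: `b` is the first element of `S` in the
sequence `a+1, a+2, …`. -/
def FollowsIn {n : ℕ} (S : Finset (ZMod n)) (a b : ZMod n) : Prop :=
  a ∈ S ∧ b ∈ S ∧ ∃ g : ℕ, 1 ≤ g ∧ a + (g : ZMod n) = b ∧
    ∀ u : ℕ, 1 ≤ u → u < g → a + (u : ZMod n) ∉ S

/-- The cyclic interval `[x, y[`: the elements of the sequence `x, x+1, x+2, …` (mod `n`)
strictly before the first occurrence of `y`. -/
def cycInt {n : ℕ} [NeZero n] (x y : ZMod n) : Finset (ZMod n) :=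
  (Finset.range ((y - x).val)).image fun u : ℕ => x + (u : ZMod n)

/-- If `b` follows `a` in a set with at least two elements, then the gap between them is
positive and less than `n`. -/
lemma FollowsIn.exists_gap {n : ℕ} [NeZero n] {S : Finset (ZMod n)} {a b : ZMod n}
    (h : FollowsIn S a b) (hS : 2 ≤ S.card) :
    ∃ g : ℕ, 1 ≤ g ∧ g < n ∧ a + (g : ZMod n) = b ∧
      ∀ u : ℕ, 1 ≤ u → u < g → a + (u : ZMod n) ∉ S := by
  obtain ⟨-, -, g, hg, hab, hu⟩ := h
  refine ⟨g, hg, ?_, hab, hu⟩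
  by_contra! hn
  obtain ⟨c, hc, hca⟩ := Finset.exists_mem_ne (by omega : 1 < S.card) a
  refine hu (c - a).val ?_ ((ZMod.val_lt _).trans_le hn) (by simpa using hc)
  exact Nat.one_le_iff_ne_zero.2 fun h0 => hca (sub_eq_zero.1 ((ZMod.val_eq_zero _).1 h0))

lemma add_natCast_mem_cycInt {n : ℕ} [NeZero n] {a : ZMod n} {g u : ℕ} (hg : g < n)
    (hu : u < n) : a + (u : ZMod n) ∈ cycInt a (a + (g : ZMod n)) ↔ u < g := by
  simp only [cycInt, add_sub_cancel_left, ZMod.val_cast_of_lt hg, Finset.mem_image,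
    Finset.mem_range, add_right_inj]
  refine ⟨?_, fun h => ⟨u, h, rfl⟩⟩
  rintro ⟨v, hv, hvu⟩
  have := congrArg ZMod.val hvu
  rw [ZMod.val_cast_of_lt (hv.trans hg), ZMod.val_cast_of_lt hu] at this
  omega

lemma Admissible.mem_iff_mem_iff {n : ℕ} {R S S' T T' : Finset (ZMod n)}
    (hT : Admissible R S T) (hT' : Admissible R S' T') {i : ZMod n} (hi : i + 1 ∉ S)
    (hi' : i + 1 ∉ S') : (i ∈ T' ↔ i ∈ T) ↔ (i + 1 ∈ T' ↔ i + 1 ∈ T) := by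
  have h := hT i hi
  have h' := hT' i hi'
  split_ifs at h h' <;> tauto

/-- For `j ∈ S` with `|S| ≥ 2` and `j⁻` the element of `S` that `j` follows, exactly one of
the following holds: either `Φ_R(S∖{j}) = Φ_R(S)`, or `Φ_R(S∖{j})` agrees with `Φ_R(S)`
outside the cyclic interval `[j⁻, j[` and is complementary to it inside `[j⁻, j[`.
Here `T = Φ_R(S)` and `T' = Φ_R(S∖{j})` are given through their characterizing
properties. -/
theorem phi_erase_dichotomy {n : ℕ} [NeZero n] (R S : Finset (ZMod n))
    (hS : 2 ≤ S.card) (j jm : ZMod n) (hj : j ∈ S) (hjm : FollowsIn S jm j)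
    (T : Finset (ZMod n)) (hTadm : Admissible R S T) (hTpos : ∀ i ∈ S, IPositive R T i)
    (T' : Finset (ZMod n)) (hT'adm : Admissible R (S.erase j) T')
    (hT'pos : ∀ i ∈ S.erase j, IPositive R T' i) :
    Xor' (T' = T)
      ((∀ i : ZMod n, i ∉ cycInt jm j → (i ∈ T' ↔ i ∈ T)) ∧
        ∀ i ∈ cycInt jm j, (i ∈ T' ↔ i ∉ T)) := by
  obtain ⟨g, hg, hgn, rfl, hgap⟩ := hjm.exists_gap hS
  have hne : ∀ u : ℕ, u < n → u ≠ g → jm + (u : ZMod n) ≠ jm + (g : ZMod n) := by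
    intro u hu hug h
    have h := congrArg ZMod.val (add_left_cancel h)
    rw [ZMod.val_cast_of_lt hu, ZMod.val_cast_of_lt hgn] at h
    exact hug h
  have hpos : ∀ i, i + 1 ∈ S → i + 1 ≠ jm + (g : ZMod n) → (i ∈ T' ↔ i ∈ T) := by
    intro i hi hij
    have h := hTpos _ hi
    have h' := hT'pos _ (Finset.mem_erase.2 ⟨hij, hi⟩)
    simp only [IPositive, add_sub_cancel_right] at h h'
    exact h'.trans h.symm
  have hstep : ∀ i, i + 1 ∉ S → ((i ∈ T' ↔ i ∈ T) ↔ (i + 1 ∈ T' ↔ i + 1 ∈ T)) := fun i hi =>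
    hTadm.mem_iff_mem_iff hT'adm hi fun h => hi (Finset.mem_of_mem_erase h)
  have hout : ∀ k u : ℕ, u + k + 1 = n → g ≤ u →
      (jm + (u : ZMod n) ∈ T' ↔ jm + (u : ZMod n) ∈ T) := by
    intro k
    induction k with
    | zero =>
      intro u hu _
      have hjm1 : jm + (u : ZMod n) + 1 = jm := by
        have : ((u + 0 + 1 : ℕ) : ZMod n) = 0 := by rw [hu, ZMod.natCast_self]
        push_cast at this
        linear_combination this
      refine hpos _ (by rw [hjm1]; exact hjm.1) ?_
      rw [hjm1]
      simpa using hne 0 (by omega) (by omega)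
    | succ k ih =>
      intro u hu hgu
      have hnext := ih (u + 1) (by omega) (by omega)
      have hj1 := hne (u + 1) (by omega) (by omega)
      rw [Nat.cast_succ, ← add_assoc] at hnext hj1
      by_cases hmem : jm + (u : ZMod n) + 1 ∈ S
      · exact hpos _ hmem hj1
      · exact (hstep _ hmem).2 hnext
  have hin : ∀ u : ℕ, u < g →
      ((jm + (u : ZMod n) ∈ T' ↔ jm + (u : ZMod n) ∈ T) ↔ (jm ∈ T' ↔ jm ∈ T)) := by
    intro u
    induction u with
    | zero => simp
    | succ u ih =>
      intro hu
      have hmem := hgap (u + 1) (by omega) hu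
      rw [Nat.cast_succ, ← add_assoc] at hmem ⊢
      rw [← hstep _ hmem]
      exact ih (by omega)
  have hrep : ∀ i : ZMod n, ∃ u : ℕ, u < n ∧ jm + (u : ZMod n) = i := fun i =>
    ⟨(i - jm).val, ZMod.val_lt _, by simp⟩
  have houtside : ∀ i, i ∉ cycInt jm (jm + (g : ZMod n)) → (i ∈ T' ↔ i ∈ T) := by
    intro i hi
    obtain ⟨u, hu, rfl⟩ := hrep i
    rw [add_natCast_mem_cycInt hgn hu] at hi
    exact hout (n - 1 - u) u (by omega) (by omega)
  have hinside : ∀ i ∈ cycInt jm (jm + (g : ZMod n)),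
      ((i ∈ T' ↔ i ∈ T) ↔ (jm ∈ T' ↔ jm ∈ T)) := by
    intro i hi
    obtain ⟨u, hu, rfl⟩ := hrep i
    exact hin u ((add_natCast_mem_cycInt hgn hu).1 hi)
  by_cases hD : jm ∈ T' ↔ jm ∈ T
  · have hjmem : jm ∈ cycInt jm (jm + (g : ZMod n)) := by
      simpa using (add_natCast_mem_cycInt (a := jm) (u := 0) hgn (by omega)).2 hg
    refine Or.inl ⟨?_, fun h => ?_⟩
    · ext i
      by_cases hi : i ∈ cycInt jm (jm + (g : ZMod n))
      · exact (hinside i hi).2 hD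
      · exact houtside i hi
    · have := h.2 jm hjmem
      tauto
  · refine Or.inr ⟨⟨houtside, fun i hi => ?_⟩, fun h => hD (by rw [h])⟩
    have := hinside i hi
    tauto
end
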